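/- Let R > 0 and 0 < r₀ < r₁, and set d₀ = r₁ − r₀. Let F and h be continuous on the closed disk D̄(0,r₁) ⊂ ℂ and holomorphic on D(0,r₁). Set r′ = min{ (3r₁/(2e))·( −1 + √(1 + 4r₀d₀/(9e·r₁²)) ), R }. Then there exists a function ψ(z,x), holomorphic on D(0,r₀) × D(0,r′) ⊂ ℂ², satisfying on this polydisk the singular PDE x²·∂²ψ/∂x² + (4xz − 2x²)·∂²ψ/∂x∂z + x²·∂²ψ/∂z² + (2x − 4z)·∂ψ/∂z − x²·F(z)·ψ = 0 together with ψ(z,0) = 1 and (∂ψ/∂x)(z,0) = h(z); and ψ is unique as a germ: any two holomorphic solutions of this PDE near (0,0) ∈ ℂ² with these two initial conditions coincide on a neighborhood of (0,0). -/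

import Mathlib

open Complex Metric

/-- The left-hand side of the singular PDE
`x² ψ_xx + (4xz − 2x²) ψ_xz + x² ψ_zz + (2x − 4z) ψ_z − x² F(z) ψ`. -/
noncomputable def singPDE (F : ℂ → ℂ) (ψ : ℂ → ℂ → ℂ) (z x : ℂ) : ℂ :=
  x^2 * deriv (deriv (ψ z)) x
    + (4*x*z - 2*x^2) * deriv (fun w => deriv (ψ w) x) z
    + x^2 * deriv (deriv (fun w => ψ w x)) z
    + (2*x - 4*z) * deriv (fun w => ψ w x) z
    - x^2 * F z * ψ z x


theorem param_deriv {f : ℂ → ℝ → ℂ} {U : Set ℂ} (hU : IsOpen U) {a b : ℝ}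
    (hc : ContinuousOn (fun p : ℂ × ℝ => f p.1 p.2) (U ×ˢ Set.uIcc a b))
    (hd : ∀ t ∈ Set.uIcc a b, DifferentiableOn ℂ (fun z => f z t) U) {z₀ : ℂ} (hz : z₀ ∈ U) :
    IntervalIntegrable (fun t => deriv (fun z => f z t) z₀) MeasureTheory.volume a b ∧
    HasDerivAt (fun z => ∫ t in a..b, f z t) (∫ t in a..b, deriv (fun z => f z t) z₀) z₀ := by
  obtain ⟨ε, hε, hball⟩ := Metric.isOpen_iff.1 hU z₀ hz
  set δ := ε / 3 with hδ
  have hδ0 : 0 < δ := by positivity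
  have hsub : closedBall z₀ (2 * δ) ⊆ U := by
    refine (closedBall_subset_ball (by linarith)).trans hball
  have hcf : ∀ z ∈ U, ContinuousOn (f z) (Set.uIcc a b) := by
    intro z hz'
    exact hc.comp (f := fun t : ℝ => (z, t)) (by fun_prop) (fun t ht => ⟨hz', ht⟩)
  obtain ⟨M, hM⟩ := ((isCompact_closedBall z₀ (2 * δ)).prod (isCompact_uIcc (a := a) (b := b))
    ).exists_bound_of_continuousOn (hc.mono (Set.prod_mono hsub le_rfl))
  have hmeas : ∀ z ∈ U, MeasureTheory.AEStronglyMeasurable (f z)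
      (MeasureTheory.volume.restrict (Set.uIoc a b)) := fun z hz' =>
    ((hcf z hz').mono Set.uIoc_subset_uIcc).aestronglyMeasurable measurableSet_uIoc
  refine intervalIntegral.hasDerivAt_integral_of_dominated_loc_of_deriv_le
    (F' := fun x t => deriv (fun z => f z t) x) (bound := fun _ => M / δ)
    (ball_mem_nhds z₀ hδ0) ?_ ?_ ?_ ?_ ?_ ?_
  · filter_upwards [hU.mem_nhds hz] with x hx using hmeas x hx
  · exact (hcf z₀ hz).intervalIntegrable
  · have hseq : Filter.Tendsto (fun n : ℕ => z₀ + (δ : ℂ) / ((n : ℂ) + 1)) Filter.atTop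
        (nhdsWithin z₀ {z₀}ᶜ) := by
      refine tendsto_nhdsWithin_iff.2 ⟨?_, ?_⟩
      · have h1 : Filter.Tendsto (fun n : ℕ => (1 : ℂ) / ((n : ℂ) + 1)) Filter.atTop (nhds 0) :=
          tendsto_one_div_add_atTop_nhds_zero_nat
        have := (h1.const_mul (δ : ℂ)).const_add z₀
        simpa [div_eq_mul_inv] using this
      · refine Filter.Eventually.of_forall fun n => ?_
        have h2 : ((n : ℂ) + 1) ≠ 0 := by exact_mod_cast Nat.succ_ne_zero n
        have h3 : (δ : ℂ) ≠ 0 := by exact_mod_cast hδ0.ne'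
        simp [h2, h3]
    refine aestronglyMeasurable_of_tendsto_ae Filter.atTop
      (f := fun (n : ℕ) t => slope (fun z => f z t) z₀ (z₀ + (δ : ℂ) / ((n : ℂ) + 1))) ?_ ?_
    · intro n
      have hin : z₀ + (δ : ℂ) / ((n : ℂ) + 1) ∈ U := by
        apply hsub
        rw [mem_closedBall, dist_eq_norm, add_sub_cancel_left, norm_div]
        have : (1 : ℝ) ≤ ‖(n : ℂ) + 1‖ := by
          have : ‖(n : ℂ) + 1‖ = (n : ℝ) + 1 := by exact_mod_cast Complex.norm_natCast (n + 1)
          rw [this]; linarith [Nat.cast_nonneg (α := ℝ) n]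
        rw [Complex.norm_real, Real.norm_of_nonneg hδ0.le]
        calc δ / ‖(n : ℂ) + 1‖ ≤ δ := div_le_self hδ0.le this
          _ ≤ 2 * δ := by linarith
      simp only [slope_def_module]
      exact ((hmeas _ hin).sub (hmeas _ hz)).const_smul
        ((z₀ + (δ : ℂ) / ((n : ℂ) + 1) - z₀)⁻¹)
    · refine (MeasureTheory.ae_restrict_iff' measurableSet_uIoc).2 (Filter.Eventually.of_forall ?_)
      intro t ht
      have hdt := ((hd t (Set.uIoc_subset_uIcc ht)).differentiableAt (hU.mem_nhds hz)).hasDerivAt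
      exact (hasDerivAt_iff_tendsto_slope.1 hdt).comp hseq
  · refine Filter.Eventually.of_forall fun t ht x hx => ?_
    have hsub2 : closedBall x δ ⊆ closedBall z₀ (2 * δ) := by
      apply closedBall_subset_closedBall'
      have := mem_ball.1 hx
      linarith
    refine Complex.norm_deriv_le_of_forall_mem_sphere_norm_le hδ0 ?_ ?_
    · refine DifferentiableOn.diffContOnCl ?_
      rw [closure_ball _ hδ0.ne']
      exact (hd t (Set.uIoc_subset_uIcc ht)).mono (hsub2.trans hsub)
    · intro w hw
      exact hM (w, t) ⟨hsub2 (sphere_subset_closedBall hw), Set.uIoc_subset_uIcc ht⟩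
  · exact intervalIntegrable_const
  · refine Filter.Eventually.of_forall fun t ht x hx => ?_
    refine ((hd t (Set.uIoc_subset_uIcc ht)).differentiableAt (hU.mem_nhds (hsub ?_))).hasDerivAt
    exact ball_subset_closedBall (ball_subset_ball (by linarith) hx)

theorem HasSum.congr_fun' {f g : ℕ → ℂ} {a : ℂ} (h : HasSum f a) (hfg : ∀ n, g n = f n) :
    HasSum g a := by
  rwa [funext hfg]

theorem HasSum.congr_both {f g : ℕ → ℂ} {a a' : ℂ} (h : HasSum f a) (hfg : ∀ n, g n = f n)
    (ha : a' = a) : HasSum g a' := by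
  rwa [funext hfg, ha]

/-- the formal sum -/
noncomputable def serS (b : ℕ → ℂ → ℂ) (z x : ℂ) : ℂ := ∑' n, b n z * x ^ n

structure GoodS (ρ σ : ℝ) (b : ℕ → ℂ → ℂ) : Prop where
  diff : ∀ n, DifferentiableOn ℂ (b n) (ball 0 ρ)
  bd : ∀ ρ' < ρ, ∀ s, 0 ≤ s → s < σ → ∃ C, ∀ n, ∀ z : ℂ, ‖z‖ ≤ ρ' → ‖b n z‖ * s ^ n ≤ C

namespace GoodS
variable {ρ σ : ℝ} {b : ℕ → ℂ → ℂ}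

theorem summ (hb : GoodS ρ σ b) {ρ' s : ℝ} (hρ : ρ' < ρ) (hs0 : 0 ≤ s) (hs : s < σ) :
    ∃ u : ℕ → ℝ, Summable u ∧ ∀ n z x, ‖z‖ ≤ ρ' → ‖x‖ ≤ s → ‖b n z * x ^ n‖ ≤ u n := by
  obtain ⟨C, hC⟩ := hb.bd ρ' hρ ((s + σ) / 2) (by linarith) (by linarith)
  have hs' : 0 < (s + σ) / 2 := by linarith
  refine ⟨fun n => C * (s / ((s + σ) / 2)) ^ n, ?_, ?_⟩
  · refine (summable_geometric_of_lt_one (by positivity) ?_).mul_left C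
    rw [div_lt_one hs']; linarith
  · intro n z x hz hx
    have h1 := hC n z hz
    show _ ≤ C * (s / ((s + σ) / 2)) ^ n
    rw [norm_mul, norm_pow, div_pow, ← mul_div_assoc, le_div_iff₀ (by positivity)]
    calc ‖b n z‖ * ‖x‖ ^ n * ((s + σ) / 2) ^ n = (‖b n z‖ * ((s + σ) / 2) ^ n) * ‖x‖ ^ n := by ring
      _ ≤ C * s ^ n := by
        gcongr
        exact le_trans (by positivity) h1

theorem dz (hb : GoodS ρ σ b) : GoodS ρ σ (fun n => deriv (b n)) where
  diff n := (hb.diff n).deriv isOpen_ball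
  bd ρ' hρ s hs0 hs := by
    obtain ⟨C, hC⟩ := hb.bd ((ρ' + ρ) / 2) (by linarith) s hs0 hs
    set δ := (ρ - ρ') / 2 with hδ
    have hδ0 : 0 < δ := by linarith
    refine ⟨C / δ, fun n z hz => ?_⟩
    have key : ‖deriv (fun w => b n w * (s : ℂ) ^ n) z‖ ≤ C / δ := by
      have hsub : closedBall z δ ⊆ ball 0 ρ := by
        intro w hw
        rw [mem_closedBall, dist_eq_norm] at hw
        rw [mem_ball_zero_iff]
        have := norm_add_le (w - z) z
        rw [sub_add_cancel] at this
        linarith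
      refine Complex.norm_deriv_le_of_forall_mem_sphere_norm_le hδ0 ?_ ?_
      · refine DifferentiableOn.diffContOnCl ?_
        rw [closure_ball _ hδ0.ne']
        exact ((hb.diff n).mono hsub).mul_const _
      · intro w hw
        rw [mem_sphere, dist_eq_norm] at hw
        rw [norm_mul, norm_pow, Complex.norm_real, Real.norm_of_nonneg hs0]
        refine hC n w ?_
        have := norm_add_le (w - z) z
        rw [sub_add_cancel] at this
        linarith
    have hz' : z ∈ ball (0 : ℂ) ρ := by rw [mem_ball_zero_iff]; linarith
    rw [deriv_mul_const ((hb.diff n).differentiableAt (isOpen_ball.mem_nhds hz'))] at key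
    rwa [norm_mul, norm_pow, Complex.norm_real, Real.norm_of_nonneg hs0] at key

theorem dx (hb : GoodS ρ σ b) : GoodS ρ σ (fun n z => ((n : ℂ) + 1) * b (n + 1) z) where
  diff n := (hb.diff (n + 1)).const_mul _
  bd ρ' hρ s hs0 hs := by
    obtain ⟨C, hC⟩ := hb.bd ρ' hρ ((s + σ) / 2) (by linarith) (by linarith)
    have hs' : 0 < (s + σ) / 2 := by linarith
    have hs'lt : s < (s + σ) / 2 := by linarith
    generalize (s + σ) / 2 = s' at *
    have hq : |s / s'| < 1 := by
      rw [abs_of_nonneg (by positivity), div_lt_one hs']; exact hs'lt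
    have ht1 := tendsto_pow_const_mul_const_pow_of_abs_lt_one 1 hq
    have ht2 := tendsto_pow_const_mul_const_pow_of_abs_lt_one 0 hq
    obtain ⟨B, hB⟩ := (ht1.add ht2).bddAbove_range
    have hC0 : 0 ≤ C ∨ ∀ n : ℕ, ∀ z : ℂ, ¬ ‖z‖ ≤ ρ' := by
      by_cases h : ∃ z : ℂ, ‖z‖ ≤ ρ'
      · obtain ⟨z, hz⟩ := h
        exact Or.inl (le_trans (by positivity) (hC 0 z hz))
      · push Not at h
        exact Or.inr fun n z => not_le.2 (h z)
    rcases hC0 with hC0 | hno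
    swap
    · exact ⟨0, fun n z hz => absurd hz (hno n z)⟩
    refine ⟨C / s' * B, fun n z hz => ?_⟩
    have h1 := hC (n + 1) z hz
    have h2 : ((n : ℝ) + 1) * (s / s') ^ n ≤ B := by
      have := hB (Set.mem_range_self n)
      simp only [pow_one, pow_zero, one_mul] at this
      linarith
    have h3 : ‖(n : ℂ) + 1‖ = (n : ℝ) + 1 := by exact_mod_cast Complex.norm_natCast (n + 1)
    rw [norm_mul, h3]
    have h4 : ‖b (n + 1) z‖ ≤ C / s' ^ (n + 1) := by rwa [le_div_iff₀ (by positivity)]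
    calc ((n : ℝ) + 1) * ‖b (n + 1) z‖ * s ^ n ≤ ((n : ℝ) + 1) * (C / s' ^ (n + 1)) * s ^ n := by
          gcongr
      _ = C / s' * (((n : ℝ) + 1) * (s / s') ^ n) := by
          rw [div_pow]; field_simp; ring
      _ ≤ _ := by gcongr

theorem hasSum (hb : GoodS ρ σ b) {z x : ℂ} (hz : ‖z‖ < ρ) (hx : ‖x‖ < σ) :
    HasSum (fun n => b n z * x ^ n) (serS b z x) := by
  obtain ⟨u, hu, hle⟩ := hb.summ hz (norm_nonneg x) hx
  exact (Summable.of_norm_bounded hu fun n => hle n z x le_rfl le_rfl).hasSum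

theorem hasDerivAt_x (hb : GoodS ρ σ b) {z x : ℂ} (hz : ‖z‖ < ρ) (hx : ‖x‖ < σ) :
    HasDerivAt (serS b z) (serS (fun n z => ((n : ℂ) + 1) * b (n + 1) z) z x) x := by
  obtain ⟨s, hs1, hs2⟩ := exists_between hx
  obtain ⟨u, hu, hle⟩ := hb.summ hz ((norm_nonneg x).trans hs1.le) hs2
  have hd : ∀ n : ℕ, DifferentiableOn ℂ (fun w => b n z * w ^ n) (ball 0 s) := by
    intro n; fun_prop
  have hle' : ∀ (n : ℕ) (w : ℂ), w ∈ ball (0 : ℂ) s → ‖b n z * w ^ n‖ ≤ u n := fun n w hw =>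
    hle n z w le_rfl (mem_ball_zero_iff.1 hw).le
  have hxs : x ∈ ball (0 : ℂ) s := mem_ball_zero_iff.2 hs1
  have h1 := Complex.hasSum_deriv_of_summable_norm hu hd isOpen_ball hle' hxs
  have h2 := (Complex.differentiableOn_tsum_of_summable_norm hu hd isOpen_ball hle').differentiableAt
    (isOpen_ball.mem_nhds hxs)
  have h3 := h2.hasDerivAt
  have h4 : serS (fun n z => ((n : ℂ) + 1) * b (n + 1) z) z x
      = deriv (fun w => ∑' n, b n z * w ^ n) x := by
    have h5 := (hasSum_nat_add_iff' 1).2 h1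
    simp only [Finset.range_one, Finset.sum_singleton, pow_zero, deriv_const', sub_zero] at h5
    refine HasSum.unique (hb.dx.hasSum hz hx) ?_
    refine h5.congr_fun' fun n => ?_
    rw [deriv_const_mul _ (by fun_prop)]
    simp
    ring
  rw [h4]; exact h3

theorem hasDerivAt_z (hb : GoodS ρ σ b) {z x : ℂ} (hz : ‖z‖ < ρ) (hx : ‖x‖ < σ) :
    HasDerivAt (fun w => serS b w x) (serS (fun n => deriv (b n)) z x) z := by
  obtain ⟨s, hs1, hs2⟩ := exists_between hz
  obtain ⟨u, hu, hle⟩ := hb.summ hs2 (norm_nonneg x) hx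
  have hd : ∀ n : ℕ, DifferentiableOn ℂ (fun w => b n w * x ^ n) (ball 0 s) := by
    intro n; exact ((hb.diff n).mono (ball_subset_ball hs2.le)).mul_const _
  have hle' : ∀ (n : ℕ) (w : ℂ), w ∈ ball (0 : ℂ) s → ‖b n w * x ^ n‖ ≤ u n := fun n w hw =>
    hle n w x (mem_ball_zero_iff.1 hw).le le_rfl
  have hxs : z ∈ ball (0 : ℂ) s := mem_ball_zero_iff.2 hs1
  have h1 := Complex.hasSum_deriv_of_summable_norm hu hd isOpen_ball hle' hxs
  have h2 := (Complex.differentiableOn_tsum_of_summable_norm hu hd isOpen_ball hle').differentiableAt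
    (isOpen_ball.mem_nhds hxs)
  have h3 := h2.hasDerivAt
  have h4 : serS (fun n => deriv (b n)) z x
      = deriv (fun w => ∑' n, b n w * x ^ n) z := by
    refine HasSum.unique (hb.dz.hasSum hz hx) ?_
    refine h1.congr_fun' fun n => ?_
    rw [deriv_mul_const ((hb.diff n).differentiableAt
      (isOpen_ball.mem_nhds (mem_ball_zero_iff.2 hz)))]
  rw [h4]; exact h3

theorem cont (hb : GoodS ρ σ b) :
    ContinuousOn (fun p : ℂ × ℂ => serS b p.1 p.2) (ball 0 ρ ×ˢ ball 0 σ) := by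
  rintro ⟨z, x⟩ ⟨hz, hx⟩
  simp only [mem_ball_zero_iff] at hz hx
  obtain ⟨s, hs1, hs2⟩ := exists_between hx
  obtain ⟨r, hr1, hr2⟩ := exists_between hz
  obtain ⟨u, hu, hle⟩ := hb.summ hr2 ((norm_nonneg x).trans hs1.le) hs2
  have : ContinuousOn (fun p : ℂ × ℂ => serS b p.1 p.2) (ball 0 r ×ˢ ball 0 s) := by
    refine continuousOn_tsum (u := u) (fun n => ?_) hu ?_
    · have h1 : ContinuousOn (fun p : ℂ × ℂ => b n p.1) (ball 0 r ×ˢ ball 0 s) :=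
        ((hb.diff n).continuousOn.mono (ball_subset_ball hr2.le)).comp continuousOn_fst
          (fun p hp => hp.1)
      exact h1.mul (by fun_prop)
    · rintro n ⟨w, y⟩ ⟨hw, hy⟩
      exact hle n w y (mem_ball_zero_iff.1 hw).le (mem_ball_zero_iff.1 hy).le
  refine (this.continuousAt ?_).continuousWithinAt
  exact (isOpen_ball.prod isOpen_ball).mem_nhds
    ⟨mem_ball_zero_iff.2 hr1, mem_ball_zero_iff.2 hs1⟩

theorem differentiableOn (hb : GoodS ρ σ b) :
    DifferentiableOn ℂ (fun p : ℂ × ℂ => serS b p.1 p.2) (ball 0 ρ ×ˢ ball 0 σ) := by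
  rintro ⟨z, x⟩ hp
  have hU : IsOpen (ball (0 : ℂ) ρ ×ˢ ball (0 : ℂ) σ) := isOpen_ball.prod isOpen_ball
  have hN := hU.mem_nhds hp
  let L : ℂ →L[ℂ] ℂ →L[ℂ] ℂ := (ContinuousLinearMap.mul ℂ ℂ)
  have hL : ∀ c : ℂ, ContinuousLinearMap.toSpanSingleton ℂ c = L c := by
    intro c
    ext
    simp [L]
  have := hasStrictFDerivAt_uncurry_coprod (𝕜 := ℂ) (u := ((z, x) : ℂ × ℂ)) (f := serS b)
    (f₁ := fun z x => L (serS (fun n => deriv (b n)) z x))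
    (f₂ := fun z x => L (serS (fun n z => ((n : ℂ) + 1) * b (n + 1) z) z x)) ?_ ?_ ?_ ?_
  · exact this.hasFDerivAt.differentiableAt.differentiableWithinAt
  · filter_upwards [hN] with v hv
    have := (hb.hasDerivAt_z (mem_ball_zero_iff.1 hv.1) (mem_ball_zero_iff.1 hv.2)).hasFDerivAt
    rw [hL] at this
    exact this
  · filter_upwards [hN] with v hv
    have := (hb.hasDerivAt_x (mem_ball_zero_iff.1 hv.1) (mem_ball_zero_iff.1 hv.2)).hasFDerivAt
    rw [hL] at this
    exact this
  · exact L.continuous.continuousAt.comp (hb.dz.cont.continuousAt hN)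
  · exact L.continuous.continuousAt.comp (hb.dx.cont.continuousAt hN)

end GoodS
/-- coefficients of the PDE operator applied to a series -/
noncomputable def pdeCoef (F : ℂ → ℂ) (b : ℕ → ℂ → ℂ) (z : ℂ) : ℕ → ℂ
  | 0 => -4 * z * deriv (b 0) z
  | 1 => 2 * deriv (b 0) z
  | (n + 2) => ((n : ℂ) + 2) * ((n : ℂ) + 1) * b (n + 2) z
      + 4 * z * ((n : ℂ) + 1) * deriv (b (n + 2)) z - 2 * (n : ℂ) * deriv (b (n + 1)) z
      + deriv (deriv (b n)) z - F z * b n z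

theorem GoodS.hasSum_pde {ρ σ : ℝ} {b : ℕ → ℂ → ℂ} (hb : GoodS ρ σ b) (F : ℂ → ℂ) {z x : ℂ}
    (hz : ‖z‖ < ρ) (hx : ‖x‖ < σ) :
    HasSum (fun n => pdeCoef F b z n * x ^ n) (singPDE F (serS b) z x) := by
  have hz' : ball (0 : ℂ) ρ ∈ nhds z := isOpen_ball.mem_nhds (mem_ball_zero_iff.2 hz)
  have hx' : ball (0 : ℂ) σ ∈ nhds x := isOpen_ball.mem_nhds (mem_ball_zero_iff.2 hx)
  have eS := hb.hasSum hz hx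
  have h1 : deriv (serS b z) =ᶠ[nhds x] serS (fun n z => ((n : ℂ) + 1) * b (n + 1) z) z := by
      filter_upwards [hx'] with y hy
      exact (hb.hasDerivAt_x hz (mem_ball_zero_iff.1 hy)).deriv
  have eA := (hb.dx.hasDerivAt_x hz hx).deriv
  rw [← h1.deriv_eq] at eA
  clear h1
  have h1 : (fun w => deriv (serS b w) x) =ᶠ[nhds z]
        fun w => serS (fun n z => ((n : ℂ) + 1) * b (n + 1) z) w x := by
      filter_upwards [hz'] with y hy
      exact (hb.hasDerivAt_x (mem_ball_zero_iff.1 hy) hx).deriv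
  have eB := (hb.dx.hasDerivAt_z hz hx).deriv
  rw [← h1.deriv_eq] at eB
  clear h1
  have h1 : deriv (fun w => serS b w x) =ᶠ[nhds z]
        fun w => serS (fun n => deriv (b n)) w x := by
      filter_upwards [hz'] with y hy
      exact (hb.hasDerivAt_z (mem_ball_zero_iff.1 hy) hx).deriv
  have eC := (hb.dz.hasDerivAt_z hz hx).deriv
  rw [← h1.deriv_eq] at eC
  clear h1
  have eD := (hb.hasDerivAt_z hz hx).deriv
  have hA := hb.dx.dx.hasSum hz hx
  have hB := hb.dx.dz.hasSum hz hx
  have hC := hb.dz.dz.hasSum hz hx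
  have hD := hb.dz.hasSum hz hx
  rw [← eA] at hA
  rw [← eB] at hB
  rw [← eC] at hC
  rw [← eD] at hD
  have hB' : ∀ n : ℕ, deriv (fun z => ((n : ℂ) + 1) * b (n + 1) z) z
      = ((n : ℂ) + 1) * deriv (b (n + 1)) z := fun n =>
    deriv_const_mul _ ((hb.diff (n + 1)).differentiableAt hz')
  simp only [hB'] at hB
  unfold singPDE
  generalize deriv (deriv (serS b z)) x = SA at *
  generalize deriv (fun w => deriv (serS b w) x) z = SB at *
  generalize deriv (deriv (fun w => serS b w x)) z = SC at *
  generalize deriv (fun w => serS b w x) z = SD at *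
  have hB1 := (hasSum_nat_add_iff' 1).2 hB
  have hD1 := (hasSum_nat_add_iff' 1).2 hD
  have hD2 := (hasSum_nat_add_iff' 2).2 hD
  refine (hasSum_nat_add_iff' 2).1 ?_
  have key := ((((((hA.mul_left (x ^ 2)).add (hB1.mul_left (4 * x * z))).sub
    (hB.mul_left (2 * x ^ 2))).add (hC.mul_left (x ^ 2))).add (hD1.mul_left (2 * x))).sub
    (hD2.mul_left (4 * z))).sub (eS.mul_left (x ^ 2 * F z))
  refine key.congr_both ?_ ?_
  · intro n
    simp only [pdeCoef]
    push_cast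
    ring
  · simp [Finset.sum_range_succ, pdeCoef]
    ring
theorem ode_bound {r : ℝ} {u g : ℂ → ℂ} (k : ℕ) (hu : DifferentiableOn ℂ u (ball 0 r))
    (hg : ∀ z ∈ ball (0 : ℂ) r, ((k : ℂ) + 1) * u z + 4 * z * deriv u z = g z)
    {z : ℂ} (hz : ‖z‖ < r) {G : ℝ} (hG : ∀ w : ℂ, ‖w‖ ≤ ‖z‖ → ‖g w‖ ≤ G) :
    ‖u z‖ ≤ G / ((k : ℝ) + 1) := by
  have hmem : ∀ t : ℝ, t ∈ Set.Icc (0 : ℝ) 1 → ‖(t : ℂ) ^ 4 * z‖ ≤ ‖z‖ := by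
    intro t ht
    rw [norm_mul, norm_pow, Complex.norm_real, Real.norm_of_nonneg ht.1]
    exact mul_le_of_le_one_left (norm_nonneg _) (pow_le_one₀ ht.1 ht.2)
  have hder : ∀ t : ℝ, t ∈ Set.Icc (0 : ℝ) 1 →
      HasDerivAt (fun t : ℝ => (t : ℂ) ^ (k + 1) * u ((t : ℂ) ^ 4 * z))
        ((t : ℂ) ^ k * g ((t : ℂ) ^ 4 * z)) t := by
    intro t ht
    have hw : (t : ℂ) ^ 4 * z ∈ ball (0 : ℂ) r :=
      mem_ball_zero_iff.2 ((hmem t ht).trans_lt hz)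
    have h1 : HasDerivAt (fun τ : ℂ => τ ^ 4 * z) (4 * (t : ℂ) ^ 3 * z) (t : ℂ) := by
      simpa using (hasDerivAt_pow 4 (t : ℂ)).mul_const z
    have h2 : HasDerivAt u _ ((t : ℂ) ^ 4 * z) :=
      (hu.differentiableAt (isOpen_ball.mem_nhds hw)).hasDerivAt
    have h3 : HasDerivAt (fun τ : ℂ => u (τ ^ 4 * z)) _ (t : ℂ) := h2.comp (t : ℂ) h1
    have h4 := ((hasDerivAt_pow (k + 1) (t : ℂ)).mul h3).comp_ofReal
    refine h4.congr_deriv ?_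
    rw [← hg _ hw]
    push_cast
    ring
  have hmain := image_norm_le_of_norm_deriv_right_le_deriv_boundary (a := 0) (b := 1)
    (f := fun t : ℝ => (t : ℂ) ^ (k + 1) * u ((t : ℂ) ^ 4 * z))
    (f' := fun t : ℝ => (t : ℂ) ^ k * g ((t : ℂ) ^ 4 * z))
    (B := fun t => t ^ (k + 1) * (G / ((k : ℝ) + 1)))
    (B' := fun t => t ^ k * G)
    (fun t ht => (hder t ht).continuousAt.continuousWithinAt)
    (fun t ht => (hder t ⟨ht.1, ht.2.le⟩).hasDerivWithinAt)
    (by simp) ?_ ?_ (x := 1) (by simp)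
  · simpa using hmain
  · intro t
    refine ((hasDerivAt_pow (k + 1) t).mul_const _).congr_deriv ?_
    have : (k : ℝ) + 1 ≠ 0 := by positivity
    push_cast
    field_simp
  · intro t ht
    rw [norm_mul, norm_pow, Complex.norm_real, Real.norm_of_nonneg ht.1]
    exact mul_le_mul_of_nonneg_left (hG _ (hmem t ⟨ht.1, ht.2.le⟩)) (pow_nonneg ht.1 _)

theorem ode_exists {r : ℝ} {g : ℂ → ℂ} (k : ℕ) (hg : DifferentiableOn ℂ g (ball 0 r)) :
    ∃ u : ℂ → ℂ, DifferentiableOn ℂ u (ball 0 r) ∧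
      ∀ z ∈ ball (0 : ℂ) r, ((k : ℂ) + 1) * u z + 4 * z * deriv u z = g z := by
  have hmem : ∀ t : ℝ, t ∈ Set.uIcc (0 : ℝ) 1 → ∀ z ∈ ball (0 : ℂ) r,
      (t : ℂ) ^ 4 * z ∈ ball (0 : ℂ) r := by
    intro t ht z hz
    rw [Set.uIcc_of_le zero_le_one] at ht
    rw [mem_ball_zero_iff] at hz ⊢
    rw [norm_mul, norm_pow, Complex.norm_real, Real.norm_of_nonneg ht.1]
    exact (mul_le_of_le_one_left (norm_nonneg _) (pow_le_one₀ ht.1 ht.2)).trans_lt hz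
  have hd4 : ∀ t z : ℂ, HasDerivAt (fun w : ℂ => t ^ 4 * w) (t ^ 4) z := by
    intro t z
    simpa using (hasDerivAt_id z).const_mul (t ^ 4)
  have hP := @param_deriv (fun z t => (t : ℂ) ^ k * g ((t : ℂ) ^ 4 * z)) (ball 0 r) isOpen_ball 0 1
    (by
      refine ContinuousOn.mul (by fun_prop) ?_
      refine hg.continuousOn.comp (by fun_prop) ?_
      rintro ⟨z, t⟩ ⟨hz, ht⟩
      exact hmem t ht z hz)
    (by
      intro t ht
      refine DifferentiableOn.const_mul ?_ _
      exact hg.comp (by fun_prop) (fun z hz => hmem t ht z hz))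
  refine ⟨fun z => ∫ t in (0 : ℝ)..1, (t : ℂ) ^ k * g ((t : ℂ) ^ 4 * z), ?_, ?_⟩
  · intro z hz
    exact (hP hz).2.differentiableAt.differentiableWithinAt
  · intro z hz
    obtain ⟨hI, hD⟩ := hP hz
    rw [hD.deriv]
    have hI0 : IntervalIntegrable (fun t : ℝ => (t : ℂ) ^ k * g ((t : ℂ) ^ 4 * z))
        MeasureTheory.volume 0 1 := by
      apply ContinuousOn.intervalIntegrable
      refine ContinuousOn.mul (by fun_prop) ?_
      exact hg.continuousOn.comp (by fun_prop) (fun t ht => hmem t ht z hz)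
    rw [← intervalIntegral.integral_const_mul, ← intervalIntegral.integral_const_mul,
      ← intervalIntegral.integral_add (hI0.const_mul _) (hI.const_mul _)]
    have hFTC := intervalIntegral.integral_eq_sub_of_hasDerivAt (a := 0) (b := 1)
      (f := fun t : ℝ => (t : ℂ) ^ (k + 1) * g ((t : ℂ) ^ 4 * z))
      (f' := fun t : ℝ => ((k : ℂ) + 1) * ((t : ℂ) ^ k * g ((t : ℂ) ^ 4 * z)) +
        4 * z * deriv (fun z => (t : ℂ) ^ k * g ((t : ℂ) ^ 4 * z)) z) ?_
      ((hI0.const_mul _).add (hI.const_mul _))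
    · rw [hFTC]
      simp
    · intro t ht
      have hw := hmem t ht z hz
      have h1 : HasDerivAt (fun τ : ℂ => τ ^ 4 * z) (4 * (t : ℂ) ^ 3 * z) (t : ℂ) := by
        simpa using (hasDerivAt_pow 4 (t : ℂ)).mul_const z
      have h2 : HasDerivAt g _ ((t : ℂ) ^ 4 * z) :=
        (hg.differentiableAt (isOpen_ball.mem_nhds hw)).hasDerivAt
      have h3 : HasDerivAt (fun τ : ℂ => g (τ ^ 4 * z)) _ (t : ℂ) := h2.comp (t : ℂ) h1
      have h4 := ((hasDerivAt_pow (k + 1) (t : ℂ)).mul h3).comp_ofReal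
      refine h4.congr_deriv ?_
      have h5 : HasDerivAt (fun w : ℂ => g ((t : ℂ) ^ 4 * w)) _ z := h2.comp z (hd4 t z)
      rw [(h5.const_mul ((t : ℂ) ^ k)).deriv]
      push_cast
      ring

theorem nagumo {r C : ℝ} {u : ℂ → ℂ} (n : ℕ) (hC : 0 ≤ C) (hu : DifferentiableOn ℂ u (ball 0 r))
    (hb : ∀ z : ℂ, ‖z‖ < r → ‖u z‖ ≤ C / (r - ‖z‖) ^ n) {z : ℂ} (hz : ‖z‖ < r) :
    ‖deriv u z‖ ≤ (3 * ((n : ℝ) + 2) * C) / (r - ‖z‖) ^ (n + 1) := by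
  set d := r - ‖z‖ with hd
  have hd0 : 0 < d := by linarith
  have hn2 : (0 : ℝ) < (n : ℝ) + 2 := by positivity
  have hn1 : (0 : ℝ) < (n : ℝ) + 1 := by positivity
  set δ := d / ((n : ℝ) + 2) with hδ
  have hδ0 : 0 < δ := by positivity
  have hδd : d - δ = d * (((n : ℝ) + 1) / ((n : ℝ) + 2)) := by
    rw [hδ]; field_simp; ring
  have hpos : 0 < d - δ := by rw [hδd]; positivity
  have hnorm : ∀ w ∈ closedBall z δ, ‖w‖ ≤ ‖z‖ + δ := by
    intro w hw
    rw [mem_closedBall, dist_eq_norm] at hw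
    have := norm_add_le (w - z) z
    rw [sub_add_cancel] at this
    linarith
  have key : ‖deriv u z‖ ≤ (C / (d - δ) ^ n) / δ := by
    refine Complex.norm_deriv_le_of_forall_mem_sphere_norm_le hδ0 ?_ ?_
    · refine DifferentiableOn.diffContOnCl ?_
      rw [closure_ball _ hδ0.ne']
      refine hu.mono fun w hw => mem_ball_zero_iff.2 ?_
      have := hnorm w hw
      linarith
    · intro w hw
      have h1 := hnorm w (sphere_subset_closedBall hw)
      refine (hb w (by linarith)).trans ?_
      exact div_le_div_of_nonneg_left hC (by positivity)
        (pow_le_pow_left₀ hpos.le (by linarith) n)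
  refine key.trans ?_
  have hexp : (((n : ℝ) + 2) / ((n : ℝ) + 1)) ^ n ≤ 3 := by
    have h1 : ((n : ℝ) + 2) / ((n : ℝ) + 1) = 1 / ((n : ℝ) + 1) + 1 := by field_simp; ring
    have h2 : ((n : ℝ) + 2) / ((n : ℝ) + 1) ≤ Real.exp (1 / ((n : ℝ) + 1)) := by
      rw [h1]; exact Real.add_one_le_exp _
    calc (((n : ℝ) + 2) / ((n : ℝ) + 1)) ^ n ≤ Real.exp (1 / ((n : ℝ) + 1)) ^ n := by gcongr
      _ = Real.exp (n * (1 / ((n : ℝ) + 1))) := by rw [← Real.exp_nat_mul]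
      _ ≤ Real.exp 1 := by
        apply Real.exp_le_exp.2
        rw [mul_one_div, div_le_one hn1]; linarith
      _ ≤ 3 := by linarith [Real.exp_one_lt_d9]
  have heq : (C / (d - δ) ^ n) / δ
      = (((n : ℝ) + 2) / ((n : ℝ) + 1)) ^ n * (((n : ℝ) + 2) * C / d ^ (n + 1)) := by
    rw [hδd, hδ, mul_pow, div_pow, div_pow, pow_succ]
    field_simp
  rw [heq]
  calc _ ≤ 3 * (((n : ℝ) + 2) * C / d ^ (n + 1)) := by gcongr
    _ = _ := by ring

theorem seq_bound {c : ℕ → ℝ} {K : ℝ} (hc0 : ∀ n, 0 ≤ c n)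
    (hc : ∀ n : ℕ, c (n + 2) ≤ 6 * c (n + 1) + (27 + K / (((n : ℝ) + 1) * ((n : ℝ) + 2))) * c n) :
    ∃ C, ∀ n, c n ≤ C * 20 ^ n := by
  obtain ⟨N, hN⟩ := exists_nat_ge K
  obtain ⟨C, hC⟩ := ((Finset.range (N + 2)).image (fun n => c n / 20 ^ n)).bddAbove
  refine ⟨C, fun n => ?_⟩
  have hC0 : 0 ≤ C := by
    have := hC (Finset.mem_coe.2 (Finset.mem_image_of_mem _ (Finset.mem_range.2
      (show 0 < N + 2 by omega))))
    refine le_trans ?_ this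
    simpa using hc0 0
  have hsmall : ∀ n < N + 2, c n ≤ C * 20 ^ n := by
    intro n hn
    have := hC (Finset.mem_coe.2 (Finset.mem_image_of_mem _ (Finset.mem_range.2 hn)))
    rwa [div_le_iff₀ (by positivity)] at this
  induction n using Nat.strong_induction_on with
  | _ n ih =>
    by_cases hn : n < N + 2
    · exact hsmall n hn
    · obtain ⟨m, rfl⟩ : ∃ m, n = m + 2 := ⟨n - 2, by omega⟩
      have h1 := ih (m + 1) (by omega)
      have h2 := ih m (by omega)
      have hm : (N : ℝ) ≤ m := by exact_mod_cast (show N ≤ m by omega)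
      have hm0 : (0 : ℝ) ≤ m := Nat.cast_nonneg m
      have hK : K / (((m : ℝ) + 1) * ((m : ℝ) + 2)) ≤ 1 := by
        rw [div_le_one (by positivity)]
        nlinarith
      have h3 : (27 + K / (((m : ℝ) + 1) * ((m : ℝ) + 2))) * c m ≤ 28 * c m := by
        have := hc0 m
        gcongr
        linarith
      have h4 := hc m
      have h5 : 0 ≤ C * 20 ^ m := by positivity
      rw [pow_succ] at h1
      rw [pow_add]
      nlinarith
theorem seq_exists {r : ℝ} {F h : ℂ → ℂ} (hF : DifferentiableOn ℂ F (ball 0 r))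
    (hh : DifferentiableOn ℂ h (ball 0 r)) :
    ∃ a : ℕ → ℂ → ℂ, a 0 = (fun _ => 1) ∧ a 1 = h ∧ (∀ n, DifferentiableOn ℂ (a n) (ball 0 r)) ∧
      ∀ n : ℕ, ∀ z ∈ ball (0 : ℂ) r,
        (((n + 1 : ℕ) : ℂ) + 1) * a (n + 2) z + 4 * z * deriv (a (n + 2)) z =
        (2 * (n : ℂ) * deriv (a (n + 1)) z - deriv (deriv (a n)) z + F z * a n z)
          / ((n : ℂ) + 1) := by
  have hT : ∀ (k : ℕ) (g : ℂ → ℂ), ∃ u : ℂ → ℂ, DifferentiableOn ℂ g (ball 0 r) →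
      DifferentiableOn ℂ u (ball 0 r) ∧
      ∀ z ∈ ball (0 : ℂ) r, ((k : ℂ) + 1) * u z + 4 * z * deriv u z = g z := by
    intro k g
    by_cases hg : DifferentiableOn ℂ g (ball 0 r)
    · obtain ⟨u, hu⟩ := ode_exists k hg
      exact ⟨u, fun _ => hu⟩
    · exact ⟨0, fun h => absurd h hg⟩
  choose T hT using hT
  let G : ℕ → (ℂ → ℂ) × (ℂ → ℂ) → ℂ → ℂ := fun n p z =>
    (2 * (n : ℂ) * deriv p.2 z - deriv (deriv p.1) z + F z * p.1 z) / ((n : ℂ) + 1)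
  let p : ℕ → (ℂ → ℂ) × (ℂ → ℂ) := fun n =>
    Nat.rec ((fun _ => 1), h) (fun n q => (q.2, T (n + 1) (G n q))) n
  have hp1 : ∀ n, (p (n + 1)).1 = (p n).2 := fun n => rfl
  have hp2 : ∀ n, (p (n + 1)).2 = T (n + 1) (G n (p n)) := fun n => rfl
  have hGd : ∀ n, DifferentiableOn ℂ (p n).1 (ball 0 r) → DifferentiableOn ℂ (p n).2 (ball 0 r) →
      DifferentiableOn ℂ (G n (p n)) (ball 0 r) := by
    intro n h1 h2
    have h3 := h2.deriv isOpen_ball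
    have h4 := (h1.deriv isOpen_ball).deriv isOpen_ball
    exact (((h3.const_mul _).sub h4).add (hF.mul h1)).div_const _
  have hpd : ∀ n, DifferentiableOn ℂ (p n).1 (ball 0 r) ∧
      DifferentiableOn ℂ (p n).2 (ball 0 r) := by
    intro n
    induction n with
    | zero => exact ⟨differentiableOn_const _, hh⟩
    | succ n ih => exact ⟨ih.2, (hT (n + 1) _ (hGd n ih.1 ih.2)).1⟩
  refine ⟨fun n => (p n).1, rfl, rfl, fun n => (hpd n).1, ?_⟩
  intro n z hz
  exact (hT (n + 1) _ (hGd n (hpd n).1 (hpd n).2)).2 z hz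

/-- majorant constants -/
noncomputable def cSeq (K H : ℝ) : ℕ → ℝ
  | 0 => 1
  | 1 => H
  | (n + 2) => 6 * cSeq K H (n + 1) + (27 + K / (((n : ℝ) + 1) * ((n : ℝ) + 2))) * cSeq K H n

theorem cSeq_nonneg {K H : ℝ} (hK : 0 ≤ K) (hH : 0 ≤ H) : ∀ n, 0 ≤ cSeq K H n
  | 0 => by simp [cSeq]
  | 1 => by simpa [cSeq] using hH
  | (n + 2) => by
    have h1 := cSeq_nonneg hK hH (n + 1)
    have h2 := cSeq_nonneg hK hH n
    rw [cSeq]; positivity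

theorem step_ineq (n A B K : ℝ) (hn : 0 ≤ n) (hA : 0 ≤ A) (hB : 0 ≤ B) :
    (2 * n * (3 * (n + 1 + 2) * A) + 3 * (n + 1 + 2) * (3 * (n + 2) * B) + K * B)
      / (n + 1) / (n + 1 + 1)
      ≤ 6 * A + (27 + K / ((n + 1) * (n + 2))) * B := by
  have h1 : (27 + K / ((n + 1) * (n + 2))) * B
      = (27 * (n + 1) * (n + 2) + K) * B / ((n + 1) * (n + 2)) := by
    field_simp
  rw [h1, div_div, div_le_iff₀ (by positivity)]
  have h2 : (6 * A + (27 * (n + 1) * (n + 2) + K) * B / ((n + 1) * (n + 2)))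
      * ((n + 1) * (n + 1 + 1)) = 6 * A * ((n + 1) * (n + 2))
        + (27 * (n + 1) * (n + 2) + K) * B := by
    field_simp
    ring
  rw [h2]
  have h3 : 0 ≤ n * B := by positivity
  have h4 : 0 ≤ n * (n * B) := by positivity
  nlinarith

theorem a_bound {r M H : ℝ} {F h : ℂ → ℂ} {a : ℕ → ℂ → ℂ} (hr : 0 < r) (hM0 : 0 ≤ M) (hH0 : 0 ≤ H)
    (hM : ∀ z : ℂ, ‖z‖ < r → ‖F z‖ ≤ M) (hH : ∀ z : ℂ, ‖z‖ < r → ‖h z‖ ≤ H)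
    (a0 : a 0 = (fun _ => 1)) (a1 : a 1 = h)
    (ad : ∀ n, DifferentiableOn ℂ (a n) (ball 0 r))
    (ar : ∀ n : ℕ, ∀ z ∈ ball (0 : ℂ) r,
        (((n + 1 : ℕ) : ℂ) + 1) * a (n + 2) z + 4 * z * deriv (a (n + 2)) z =
        (2 * (n : ℂ) * deriv (a (n + 1)) z - deriv (deriv (a n)) z + F z * a n z)
          / ((n : ℂ) + 1)) :
    ∀ n : ℕ, ∀ z : ℂ, ‖z‖ < r → ‖a n z‖ ≤ cSeq (M * r ^ 2) (H * r) n / (r - ‖z‖) ^ n := by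
  have c0 := cSeq_nonneg (K := M * r ^ 2) (H := H * r) (by positivity) (by positivity)
  intro n
  induction n using Nat.strong_induction_on with
  | _ n ih =>
    match n, ih with
    | 0, _ => intro z hz; simp [a0, cSeq]
    | 1, _ =>
      intro z hz
      have hd : 0 < r - ‖z‖ := by linarith
      rw [a1, cSeq, pow_one, le_div_iff₀ hd]
      have := hH z hz
      have h0 := norm_nonneg z
      have h1 := norm_nonneg (h z)
      nlinarith
    | (n + 2), ih =>
      intro z hz
      have ih1 := ih (n + 1) (by omega)
      have ih0 := ih n (by omega)
      have hd : 0 < r - ‖z‖ := by linarith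
      set A := cSeq (M * r ^ 2) (H * r) (n + 1) with hA
      set B := cSeq (M * r ^ 2) (H * r) n with hB
      have hA0 : 0 ≤ A := c0 _
      have hB0 : 0 ≤ B := c0 _
      have hn0 : (0 : ℝ) ≤ n := Nat.cast_nonneg n
      have hob := ode_bound (n + 1) (ad (n + 2)) (ar n) hz
        (G := ((2 * (n : ℝ) * (3 * ((n : ℝ) + 1 + 2) * A)
          + 3 * ((n : ℝ) + 1 + 2) * (3 * ((n : ℝ) + 2) * B) + (M * r ^ 2) * B) / ((n : ℝ) + 1))
            / (r - ‖z‖) ^ (n + 2)) ?_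
      · refine hob.trans ?_
        rw [cSeq, div_right_comm]
        push_cast
        gcongr
        exact step_ineq _ _ _ _ hn0 hA0 hB0
      · intro w hw
        have hwr : ‖w‖ < r := hw.trans_lt hz
        have hdw : 0 < r - ‖w‖ := by linarith
        have n1 := nagumo (n + 1) hA0 (ad (n + 1)) ih1 hwr
        have n2 := nagumo (n + 1) (by positivity) ((ad n).deriv isOpen_ball)
          (fun v hv => nagumo n hB0 (ad n) ih0 hv) hwr
        have n3 := ih0 w hwr
        push_cast at n1 n2
        have n4 : ‖F w * a n w‖ ≤ (M * r ^ 2 * B) / (r - ‖w‖) ^ (n + 2) := by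
          rw [norm_mul]
          calc ‖F w‖ * ‖a n w‖ ≤ M * (B / (r - ‖w‖) ^ n) := by
                gcongr
                exact hM w hwr
            _ = (M * (r - ‖w‖) ^ 2 * B) / (r - ‖w‖) ^ (n + 2) := by
                rw [pow_add]; field_simp
            _ ≤ _ := by
                gcongr
                linarith [norm_nonneg w]
        have hN1 : ‖(n : ℂ) + 1‖ = (n : ℝ) + 1 := by exact_mod_cast Complex.norm_natCast (n + 1)
        have hN2 : ‖2 * (n : ℂ)‖ = 2 * (n : ℝ) := by simp
        rw [norm_div, hN1, div_right_comm]
        gcongr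
        have t1 := norm_add_le (2 * (n : ℂ) * deriv (a (n + 1)) w - deriv (deriv (a n)) w)
          (F w * a n w)
        have t2 := norm_sub_le (2 * (n : ℂ) * deriv (a (n + 1)) w) (deriv (deriv (a n)) w)
        rw [norm_mul, hN2] at t2
        have t3 := mul_le_mul_of_nonneg_left n1 (show 0 ≤ 2 * (n : ℝ) by positivity)
        calc _ ≤ 2 * (n : ℝ) * (3 * ((n : ℝ) + 1 + 2) * A / (r - ‖w‖) ^ (n + 1 + 1))
              + 3 * ((n : ℝ) + 1 + 2) * (3 * ((n : ℝ) + 2) * B) / (r - ‖w‖) ^ (n + 1 + 1)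
              + (M * r ^ 2 * B) / (r - ‖w‖) ^ (n + 2) := by linarith
          _ = (2 * (n : ℝ) * (3 * ((n : ℝ) + 1 + 2) * A)
          + 3 * ((n : ℝ) + 1 + 2) * (3 * ((n : ℝ) + 2) * B) + (M * r ^ 2) * B)
            / (r - ‖w‖) ^ (n + 2) := by ring
          _ ≤ _ := by
            exact div_le_div_of_nonneg_left (by positivity) (by positivity)
              (pow_le_pow_left₀ hd.le (by linarith) _)
theorem cauchy_sum {s : ℝ} {f : ℂ → ℂ} (hs0 : 0 < s) (hd : DifferentiableOn ℂ f (closedBall 0 s))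
    {x : ℂ} (hx : ‖x‖ < s) :
    f x = ∑' n, (cauchyPowerSeries f 0 s).coeff n * x ^ n := by
  lift s to NNReal using hs0.le
  have hP := hd.hasFPowerSeriesOnBall (NNReal.coe_pos.1 hs0)
  have hS := hP.hasSum (y := x) (by
    rw [Metric.eball_coe]
    exact mem_ball_zero_iff.2 hx)
  rw [zero_add] at hS
  refine (HasSum.congr_fun' hS fun n => ?_).tsum_eq.symm
  rw [FormalMultilinearSeries.apply_eq_pow_smul_coeff, smul_eq_mul, mul_comm]

theorem taylor_good {ρ σ s : ℝ} {φ : ℂ → ℂ → ℂ} (hs0 : 0 < s) (hs : s < σ)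
    (hφ : DifferentiableOn ℂ (fun p : ℂ × ℂ => φ p.1 p.2) (ball 0 ρ ×ˢ ball 0 σ)) :
    ∃ a : ℕ → ℂ → ℂ, GoodS ρ s a ∧ ∀ z x : ℂ, ‖z‖ < ρ → ‖x‖ < s → φ z x = serS a z x := by
  have hcirc : ∀ θ : ℝ, circleMap (0 : ℂ) s θ ∈ ball (0 : ℂ) σ := by
    intro θ
    rw [mem_ball_zero_iff, norm_circleMap_zero, abs_of_pos hs0]; exact hs
  have hne : ∀ θ : ℝ, circleMap (0 : ℂ) s θ ≠ 0 := fun θ => circleMap_ne_center hs0.ne'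
  have hcirc' : ContinuousOn (fun p : ℂ × ℝ => φ p.1 (circleMap 0 s p.2))
      (ball 0 ρ ×ˢ Set.univ) := by
    refine hφ.continuousOn.comp (f := fun p : ℂ × ℝ => (p.1, circleMap 0 s p.2)) ?_ ?_
    · fun_prop
    · rintro ⟨z, t⟩ ⟨hz, -⟩
      exact ⟨hz, hcirc t⟩
  refine ⟨fun n z => (cauchyPowerSeries (φ z) 0 s).coeff n, ⟨?_, ?_⟩, ?_⟩
  · intro n
    have heq : (fun z => (cauchyPowerSeries (φ z) 0 s).coeff n) = fun z =>
        (2 * Real.pi * I : ℂ)⁻¹ * ∫ θ in (0 : ℝ)..2 * Real.pi,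
          deriv (circleMap 0 s) θ * (((1 : ℂ) / circleMap 0 s θ) ^ n *
            ((circleMap 0 s θ)⁻¹ * φ z (circleMap 0 s θ))) := by
      funext z
      have := cauchyPowerSeries_apply (φ z) 0 s n 1
      simp only [sub_zero, smul_eq_mul, circleIntegral] at this
      exact this
    rw [heq]
    refine DifferentiableOn.const_mul ?_ _
    intro z hz
    refine (param_deriv (U := ball 0 ρ) isOpen_ball ?_ ?_ hz).2.differentiableAt.differentiableWithinAt
    · have h1 : ContinuousOn (fun p : ℂ × ℝ => φ p.1 (circleMap 0 s p.2))
        (ball 0 ρ ×ˢ Set.uIcc 0 (2 * Real.pi)) := hcirc'.mono (Set.prod_mono le_rfl (by simp))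
      have h2 : Continuous (fun p : ℂ × ℝ => (circleMap 0 s p.2)⁻¹) :=
        Continuous.inv₀ (by fun_prop) (fun p => hne p.2)
      have h3 : Continuous (fun p : ℂ × ℝ => deriv (circleMap 0 s) p.2) := by
        simp only [deriv_circleMap]
        fun_prop
      simp only [one_div]
      exact h3.continuousOn.mul ((h2.pow n).continuousOn.mul (h2.continuousOn.mul h1))
    · intro t ht
      refine DifferentiableOn.const_mul (DifferentiableOn.const_mul (DifferentiableOn.const_mul ?_ _) _) _
      refine hφ.comp (f := fun z : ℂ => (z, circleMap 0 s t)) ?_ ?_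
      · fun_prop
      · intro w hw
        exact ⟨hw, hcirc t⟩
  · intro ρ' hρ' s' hs'0 hs'
    obtain ⟨M, hM⟩ := ((isCompact_closedBall (0 : ℂ) ρ').prod (isCompact_sphere (0 : ℂ) s)
      ).exists_bound_of_continuousOn (hφ.continuousOn.mono (Set.prod_mono
        (closedBall_subset_ball hρ') (sphere_subset_closedBall.trans (closedBall_subset_ball hs))))
    refine ⟨M, fun n z hz => ?_⟩
    have hMθ : ∀ θ : ℝ, ‖φ z (circleMap 0 s θ)‖ ≤ M := fun θ =>
      hM (z, circleMap 0 s θ) ⟨by simpa using hz, circleMap_mem_sphere _ hs0.le θ⟩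
    have hM0 : 0 ≤ M := (norm_nonneg _).trans (hMθ 0)
    have h1 := norm_cauchyPowerSeries_le (φ z) 0 s n
    have h2 : ‖(cauchyPowerSeries (φ z) 0 s).coeff n‖ ≤ ‖cauchyPowerSeries (φ z) 0 s n‖ := by
      rw [FormalMultilinearSeries.norm_apply_eq_norm_coef]
    have h3 : ∫ θ : ℝ in 0..2 * Real.pi, ‖φ z (circleMap 0 s θ)‖ ≤ M * (2 * Real.pi) := by
      have h4 := intervalIntegral.norm_integral_le_of_norm_le_const (a := 0) (b := 2 * Real.pi)
        (f := fun θ : ℝ => ‖φ z (circleMap 0 s θ)‖) (C := M) (fun θ _ => by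
          rw [norm_norm]; exact hMθ θ)
      rw [sub_zero, abs_of_pos Real.two_pi_pos] at h4
      exact (le_abs_self _).trans h4
    have h5 : (2 * Real.pi)⁻¹ * ∫ θ : ℝ in 0..2 * Real.pi, ‖φ z (circleMap 0 s θ)‖ ≤ M := by
      rw [inv_mul_le_iff₀ Real.two_pi_pos]; linarith
    rw [abs_of_pos hs0] at h1
    calc ‖(cauchyPowerSeries (φ z) 0 s).coeff n‖ * s' ^ n
        ≤ (M * s⁻¹ ^ n) * s' ^ n := by
          gcongr
          exact h2.trans (h1.trans (by gcongr))
      _ = M * (s' / s) ^ n := by rw [div_pow, inv_pow]; field_simp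
      _ ≤ M := by
        refine mul_le_of_le_one_right hM0 (pow_le_one₀ (by positivity) ?_)
        rw [div_le_one hs0]; exact hs'.le
  · intro z x hz hx
    have hd : DifferentiableOn ℂ (φ z) (closedBall 0 s) := by
      refine hφ.comp (f := fun x : ℂ => (z, x)) (by fun_prop) ?_
      intro y hy
      exact ⟨mem_ball_zero_iff.2 hz, closedBall_subset_ball hs hy⟩
    exact cauchy_sum hs0 hd hx

theorem singPDE_congr {ρ σ : ℝ} {φ χ : ℂ → ℂ → ℂ} (F : ℂ → ℂ)
    (hE : ∀ z x : ℂ, ‖z‖ < ρ → ‖x‖ < σ → φ z x = χ z x) {z x : ℂ} (hz : ‖z‖ < ρ) (hx : ‖x‖ < σ) :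
    singPDE F φ z x = singPDE F χ z x := by
  have hz' : ball (0 : ℂ) ρ ∈ nhds z := isOpen_ball.mem_nhds (mem_ball_zero_iff.2 hz)
  have hx' : ball (0 : ℂ) σ ∈ nhds x := isOpen_ball.mem_nhds (mem_ball_zero_iff.2 hx)
  have e1 : ∀ w : ℂ, ‖w‖ < ρ → φ w =ᶠ[nhds x] χ w := fun w hw => by
    filter_upwards [hx'] with y hy using hE w y hw (mem_ball_zero_iff.1 hy)
  have e2 : (fun w => φ w x) =ᶠ[nhds z] fun w => χ w x := by
    filter_upwards [hz'] with w hw using hE w x (mem_ball_zero_iff.1 hw) hx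
  have e3 : (fun w => deriv (φ w) x) =ᶠ[nhds z] fun w => deriv (χ w) x := by
    filter_upwards [hz'] with w hw using (e1 w (mem_ball_zero_iff.1 hw)).deriv_eq
  unfold singPDE
  rw [(e1 z hz).deriv.deriv_eq, e3.deriv_eq, e2.deriv.deriv_eq, e2.deriv_eq, hE z x hz hx]

theorem coef_zero {s : ℝ} {c : ℕ → ℂ} (hs : 0 < s)
    (h : ∀ x : ℂ, ‖x‖ < s → HasSum (fun n => c n * x ^ n) 0) (n : ℕ) : c n = 0 := by
  have hp : HasFPowerSeriesAt (0 : ℂ → ℂ) (FormalMultilinearSeries.ofScalars ℂ c) 0 := by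
    rw [hasFPowerSeriesAt_iff]
    filter_upwards [isOpen_ball.mem_nhds (mem_ball_self hs)] with x hx
    refine HasSum.congr_fun' (h x (mem_ball_zero_iff.1 hx)) fun n => ?_
    simp [FormalMultilinearSeries.coeff_ofScalars, mul_comm]
  have h0 := hp.eq_zero
  have := congrArg (fun p => FormalMultilinearSeries.coeff p n) h0
  simp only [FormalMultilinearSeries.coeff_ofScalars] at this
  rw [this]
  rfl

theorem serS_zero (b : ℕ → ℂ → ℂ) (z : ℂ) : serS b z 0 = b 0 z := by
  unfold serS
  rw [tsum_eq_single 0]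
  · simp
  · intro n hn
    simp [hn]

theorem GoodS.deriv_zero {ρ σ : ℝ} {b : ℕ → ℂ → ℂ} (hb : GoodS ρ σ b) (hσ : 0 < σ) {z : ℂ}
    (hz : ‖z‖ < ρ) : deriv (serS b z) 0 = b 1 z := by
  rw [(hb.hasDerivAt_x hz (by simpa using hσ)).deriv, serS_zero]
  simp

theorem coef_unique {r : ℝ} {F : ℂ → ℂ} {a c : ℕ → ℂ → ℂ}
    (ad : ∀ n, DifferentiableOn ℂ (a n) (ball 0 r)) (cd : ∀ n, DifferentiableOn ℂ (c n) (ball 0 r))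
    (h0 : ∀ z : ℂ, ‖z‖ < r → a 0 z = c 0 z) (h1 : ∀ z : ℂ, ‖z‖ < r → a 1 z = c 1 z)
    (ha : ∀ n, ∀ z : ℂ, ‖z‖ < r → pdeCoef F a z n = 0)
    (hc : ∀ n, ∀ z : ℂ, ‖z‖ < r → pdeCoef F c z n = 0) :
    ∀ n, ∀ z : ℂ, ‖z‖ < r → a n z = c n z := by
  intro n
  induction n using Nat.strong_induction_on with
  | _ n ih =>
    match n, ih with
    | 0, _ => exact h0
    | 1, _ => exact h1
    | (n + 2), ih =>
      intro z hz
      have hE : ∀ m, m < n + 2 → ∀ w : ℂ, ‖w‖ < r → a m =ᶠ[nhds w] c m := by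
        intro m hm w hw
        filter_upwards [isOpen_ball.mem_nhds (mem_ball_zero_iff.2 hw)] with y hy
        exact ih m hm y (mem_ball_zero_iff.1 hy)
      have hb := ode_bound (r := r) (u := fun w => a (n + 2) w - c (n + 2) w) (g := fun _ => 0)
        (n + 1) ((ad _).sub (cd _)) ?_ hz (G := 0) (by simp)
      · rw [zero_div] at hb
        exact sub_eq_zero.1 (norm_le_zero_iff.1 hb)
      · intro w hw
        have hw' := mem_ball_zero_iff.1 hw
        have e1 := ha (n + 2) w hw'
        have e2 := hc (n + 2) w hw'
        have d1 := ((ad (n + 2)).differentiableAt (isOpen_ball.mem_nhds hw))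
        have d2 := ((cd (n + 2)).differentiableAt (isOpen_ball.mem_nhds hw))
        rw [pdeCoef] at e1 e2
        rw [(hE (n + 1) (by omega) w hw').deriv_eq, (hE n (by omega) w hw').deriv.deriv_eq,
          ih n (by omega) w hw'] at e1
        have hn : ((n : ℂ) + 1) ≠ 0 := by exact_mod_cast Nat.succ_ne_zero n
        rw [deriv_fun_sub d1 d2]
        apply mul_left_cancel₀ hn
        push_cast
        linear_combination e1 - e2

theorem germ_data {ρ : ℝ} {F h : ℂ → ℂ} {φ : ℂ → ℂ → ℂ} (hρ : 0 < ρ)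
    (hφ : DifferentiableOn ℂ (fun p : ℂ × ℂ => φ p.1 p.2) (ball 0 ρ ×ˢ ball 0 ρ))
    (hP : ∀ z x : ℂ, ‖z‖ < ρ → ‖x‖ < ρ → singPDE F φ z x = 0)
    (hi : ∀ z : ℂ, ‖z‖ < ρ → φ z 0 = 1 ∧ deriv (φ z) 0 = h z) :
    ∃ a : ℕ → ℂ → ℂ, (∀ n, DifferentiableOn ℂ (a n) (ball 0 ρ)) ∧
      (∀ z x : ℂ, ‖z‖ < ρ → ‖x‖ < ρ / 2 → φ z x = serS a z x) ∧
      (∀ z : ℂ, ‖z‖ < ρ → a 0 z = 1) ∧ (∀ z : ℂ, ‖z‖ < ρ → a 1 z = h z) ∧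
      ∀ n, ∀ z : ℂ, ‖z‖ < ρ → pdeCoef F a z n = 0 := by
  have hs : 0 < ρ / 2 := by linarith
  obtain ⟨a, hg, he⟩ := taylor_good hs (by linarith) hφ
  refine ⟨a, hg.diff, he, ?_, ?_, ?_⟩
  · intro z hz
    rw [← serS_zero a z, ← he z 0 hz (by simpa using hs)]
    exact (hi z hz).1
  · intro z hz
    rw [← hg.deriv_zero hs hz, ← (hi z hz).2]
    apply Filter.EventuallyEq.deriv_eq
    filter_upwards [isOpen_ball.mem_nhds (mem_ball_self hs)] with x hx
    exact (he z x hz (mem_ball_zero_iff.1 hx)).symm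
  · intro n z hz
    refine coef_zero hs (fun x hx => ?_) n
    have := hg.hasSum_pde F hz hx
    rwa [← singPDE_congr F he hz hx, hP z x hz (by linarith)] at this

theorem germ_unique {V : Set (ℂ × ℂ)} {F h : ℂ → ℂ} {φ χ : ℂ → ℂ → ℂ} (hV : IsOpen V)
    (h0 : ((0 : ℂ), (0 : ℂ)) ∈ V)
    (hφ : DifferentiableOn ℂ (fun p : ℂ × ℂ => φ p.1 p.2) V)
    (hχ : DifferentiableOn ℂ (fun p : ℂ × ℂ => χ p.1 p.2) V)
    (pφ : ∀ p ∈ V, singPDE F φ p.1 p.2 = 0) (pχ : ∀ p ∈ V, singPDE F χ p.1 p.2 = 0)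
    (iφ : ∀ z : ℂ, (z, (0 : ℂ)) ∈ V → φ z 0 = 1 ∧ deriv (φ z) 0 = h z)
    (iχ : ∀ z : ℂ, (z, (0 : ℂ)) ∈ V → χ z 0 = 1 ∧ deriv (χ z) 0 = h z) :
    ∃ W : Set (ℂ × ℂ), IsOpen W ∧ ((0 : ℂ), (0 : ℂ)) ∈ W ∧
      ∀ p ∈ W, φ p.1 p.2 = χ p.1 p.2 := by
  obtain ⟨ρ, hρ, hsub⟩ : ∃ ρ : ℝ, 0 < ρ ∧ ball (0 : ℂ) ρ ×ˢ ball (0 : ℂ) ρ ⊆ V := by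
    obtain ⟨ρ, hρ, hsub⟩ := Metric.isOpen_iff.1 hV _ h0
    exact ⟨ρ, hρ, by rwa [ball_prod_same]⟩
  have hm : ∀ z x : ℂ, ‖z‖ < ρ → ‖x‖ < ρ → (z, x) ∈ V := fun z x hz hx =>
    hsub (Set.mk_mem_prod (mem_ball_zero_iff.2 hz) (mem_ball_zero_iff.2 hx))
  obtain ⟨a, ad, ae, a0, a1, ap⟩ := germ_data hρ (hφ.mono hsub)
    (fun z x hz hx => pφ (z, x) (hm z x hz hx)) (fun z hz => iφ z (hm z 0 hz (by simpa using hρ)))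
  obtain ⟨c, cd, ce, c0, c1, cp⟩ := germ_data hρ (hχ.mono hsub)
    (fun z x hz hx => pχ (z, x) (hm z x hz hx)) (fun z hz => iχ z (hm z 0 hz (by simpa using hρ)))
  have hu := coef_unique ad cd (fun z hz => (a0 z hz).trans (c0 z hz).symm)
    (fun z hz => (a1 z hz).trans (c1 z hz).symm) ap cp
  refine ⟨ball 0 ρ ×ˢ ball 0 (ρ / 2), isOpen_ball.prod isOpen_ball,
    Set.mk_mem_prod (mem_ball_self hρ) (mem_ball_self (by linarith)), ?_⟩
  rintro ⟨z, x⟩ ⟨hz, hx⟩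
  rw [mem_ball_zero_iff] at hz hx
  change φ z x = χ z x
  rw [ae z x hz hx, ce z x hz hx]
  unfold serS
  exact tsum_congr fun n => by rw [hu n z hz]

theorem radius_le {R r₀ r₁ d₀ r' : ℝ} (hr₀ : 0 < r₀) (hr₀₁ : r₀ < r₁) (hd₀ : d₀ = r₁ - r₀)
    (hr' : r' = min ((3*r₁/(2*Real.exp 1)) *
      (-1 + Real.sqrt (1 + 4*r₀*d₀/(9*Real.exp 1*r₁^2)))) R) : r' ≤ d₀ / 20 := by
  have he : 2.7 < Real.exp 1 := lt_trans (by norm_num) Real.exp_one_gt_d9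
  have hd : 0 < d₀ := by linarith
  have hr1 : 0 < r₁ := by linarith
  set e := Real.exp 1
  have he0 : 0 < e := by linarith
  set s := 4*r₀*d₀/(9*e*r₁^2) with hs
  have hs0 : 0 ≤ s := by positivity
  have h1 : Real.sqrt (1 + s) ≤ 1 + s / 2 := by
    rw [Real.sqrt_le_left (by positivity)]
    nlinarith [sq_nonneg s]
  calc r' ≤ (3*r₁/(2*e)) * (-1 + Real.sqrt (1 + s)) := by rw [hr']; exact min_le_left _ _
    _ ≤ (3*r₁/(2*e)) * (s / 2) := by gcongr; linarith
    _ = (r₀ * d₀) / (3 * e ^ 2 * r₁) := by rw [hs]; field_simp; ring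
    _ ≤ d₀ / 20 := by
      rw [div_le_div_iff₀ (by positivity) (by norm_num)]
      have h2 : 20 ≤ 3 * e ^ 2 := by nlinarith
      calc r₀ * d₀ * 20 ≤ r₁ * d₀ * (3 * e ^ 2) := by gcongr
        _ = d₀ * (3 * e ^ 2 * r₁) := by ring

theorem exist_good {r₀ r₁ : ℝ} {F h : ℂ → ℂ} (hr₀ : 0 < r₀) (hr₀₁ : r₀ < r₁)
    (hFc : ContinuousOn F (closedBall 0 r₁)) (hFd : DifferentiableOn ℂ F (ball 0 r₁))
    (hhc : ContinuousOn h (closedBall 0 r₁)) (hhd : DifferentiableOn ℂ h (ball 0 r₁)) :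
    ∃ a : ℕ → ℂ → ℂ, GoodS r₀ ((r₁ - r₀) / 20) a ∧ a 0 = (fun _ => 1) ∧ a 1 = h ∧
      ∀ n, ∀ z : ℂ, ‖z‖ < r₁ → pdeCoef F a z n = 0 := by
  have hr1 : 0 < r₁ := hr₀.trans hr₀₁
  obtain ⟨M, hM⟩ := (isCompact_closedBall (0 : ℂ) r₁).exists_bound_of_continuousOn hFc
  obtain ⟨H, hH⟩ := (isCompact_closedBall (0 : ℂ) r₁).exists_bound_of_continuousOn hhc
  have hM0 : 0 ≤ M := (norm_nonneg _).trans (hM 0 (by simpa using hr1.le))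
  have hH0 : 0 ≤ H := (norm_nonneg _).trans (hH 0 (by simpa using hr1.le))
  obtain ⟨a, a0, a1, ad, ar⟩ := seq_exists hFd hhd
  have hab := a_bound hr1 hM0 hH0 (fun z hz => hM z (by simpa using hz.le))
    (fun z hz => hH z (by simpa using hz.le)) a0 a1 ad ar
  obtain ⟨C, hC⟩ := seq_bound (c := cSeq (M * r₁ ^ 2) (H * r₁)) (K := M * r₁ ^ 2)
    (cSeq_nonneg (by positivity) (by positivity)) (fun n => by rw [cSeq])
  have hC0 : 0 ≤ C := by
    have := hC 0
    simp [cSeq] at this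
    linarith
  refine ⟨a, ⟨fun n => (ad n).mono (ball_subset_ball hr₀₁.le), ?_⟩, a0, a1, ?_⟩
  · intro ρ' hρ' s hs0 hs
    refine ⟨C, fun n z hz => ?_⟩
    have hz1 : ‖z‖ < r₁ := by linarith
    have hd : r₁ - r₀ ≤ r₁ - ‖z‖ := by linarith
    have hd0 : 0 < r₁ - r₀ := by linarith
    have hdz : 0 < r₁ - ‖z‖ := by linarith
    calc ‖a n z‖ * s ^ n ≤ (C * 20 ^ n / (r₁ - ‖z‖) ^ n) * ((r₁ - ‖z‖) / 20) ^ n := by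
          gcongr
          · exact (hab n z hz1).trans (by gcongr; exact hC n)
          · linarith
      _ = C := by rw [div_pow]; field_simp
  · intro n z hz
    match n with
    | 0 => simp [pdeCoef, a0]
    | 1 => simp [pdeCoef, a0]
    | (n + 2) =>
      have hn : ((n : ℂ) + 1) ≠ 0 := by exact_mod_cast Nat.succ_ne_zero n
      have := ar n z (mem_ball_zero_iff.2 hz)
      rw [eq_div_iff hn] at this
      push_cast at this
      rw [pdeCoef]
      linear_combination this

/-- Existence of a holomorphic solution `ψ` of the singular PDE on
`D(0,r₀) × D(0,r′)` with `ψ(z,0)=1`, `ψ_x(z,0)=h(z)`, and uniqueness of the germ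
of such a solution at `(0,0)`. -/
theorem singular_pde_existence_uniqueness (R r₀ r₁ d₀ r' : ℝ)
    (hR : 0 < R) (hr₀ : 0 < r₀) (hr₀₁ : r₀ < r₁) (hd₀ : d₀ = r₁ - r₀)
    (hr' : r' = min ((3*r₁/(2*Real.exp 1)) *
      (-1 + Real.sqrt (1 + 4*r₀*d₀/(9*Real.exp 1*r₁^2)))) R)
    (F h : ℂ → ℂ)
    (hFc : ContinuousOn F (Metric.closedBall 0 r₁))
    (hFd : DifferentiableOn ℂ F (Metric.ball 0 r₁))
    (hhc : ContinuousOn h (Metric.closedBall 0 r₁))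
    (hhd : DifferentiableOn ℂ h (Metric.ball 0 r₁)) :
    (∃ ψ : ℂ → ℂ → ℂ,
      DifferentiableOn ℂ (fun p : ℂ × ℂ => ψ p.1 p.2)
        (Metric.ball 0 r₀ ×ˢ Metric.ball 0 r') ∧
      (∀ z ∈ Metric.ball (0 : ℂ) r₀, ∀ x ∈ Metric.ball (0 : ℂ) r',
        singPDE F ψ z x = 0) ∧
      (∀ z ∈ Metric.ball (0 : ℂ) r₀, ψ z 0 = 1 ∧ deriv (ψ z) 0 = h z)) ∧
    (∀ V : Set (ℂ × ℂ), IsOpen V → ((0 : ℂ), (0 : ℂ)) ∈ V →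
      ∀ ψ₁ ψ₂ : ℂ → ℂ → ℂ,
        DifferentiableOn ℂ (fun p : ℂ × ℂ => ψ₁ p.1 p.2) V →
        DifferentiableOn ℂ (fun p : ℂ × ℂ => ψ₂ p.1 p.2) V →
        (∀ p ∈ V, singPDE F ψ₁ p.1 p.2 = 0) →
        (∀ p ∈ V, singPDE F ψ₂ p.1 p.2 = 0) →
        (∀ z : ℂ, (z, (0 : ℂ)) ∈ V → ψ₁ z 0 = 1 ∧ deriv (ψ₁ z) 0 = h z) →
        (∀ z : ℂ, (z, (0 : ℂ)) ∈ V → ψ₂ z 0 = 1 ∧ deriv (ψ₂ z) 0 = h z) →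
        ∃ W : Set (ℂ × ℂ), IsOpen W ∧ ((0 : ℂ), (0 : ℂ)) ∈ W ∧
          ∀ p ∈ W, ψ₁ p.1 p.2 = ψ₂ p.1 p.2) := by
  have hle := radius_le hr₀ hr₀₁ hd₀ hr'
  refine ⟨?_, fun V hV h0 ψ₁ ψ₂ d1 d2 p1 p2 i1 i2 => germ_unique hV h0 d1 d2 p1 p2 i1 i2⟩
  obtain ⟨a, hg, a0, a1, ap⟩ := exist_good hr₀ hr₀₁ hFc hFd hhc hhd
  rw [← hd₀] at hg
  have hd : 0 < d₀ / 20 := by linarith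
  refine ⟨serS a, hg.differentiableOn.mono (Set.prod_mono le_rfl (ball_subset_ball hle)), ?_, ?_⟩
  · intro z hz x hx
    rw [mem_ball_zero_iff] at hz hx
    have h1 := hg.hasSum_pde F hz (hx.trans_le hle)
    refine h1.unique (hasSum_zero.congr_fun' fun n => ?_)
    rw [ap n z (hz.trans hr₀₁), zero_mul]
  · intro z hz
    rw [mem_ball_zero_iff] at hz
    rw [serS_zero, hg.deriv_zero hd hz, a0, a1]
    exact ⟨rfl, rfl⟩
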